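/- arXiv:1403.3644 — 6 statements merged into one kernel-verified Lean document; each statement's English description precedes it below -/
import Mathlib

section
/- For each integer n ≥ 2 the ℤ-module ℚ ⊗_ℤ (ℤ/nℤ) is zero, so the target of the canonical ℤ-linear map ζ : ℚ ⊗_ℤ (∏_{n ≥ 2} ℤ/nℤ) → ∏_{n ≥ 2} (ℚ ⊗_ℤ ℤ/nℤ), determined by x ⊗ (a_n)_n ↦ (x ⊗ a_n)_n, is the zero module; nevertheless ℚ ⊗_ℤ (∏_{n ≥ 2} ℤ/nℤ) is a nonzero module. In particular ζ is not injective. -/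
open scoped TensorProduct

namespace Stmt4

/-- The canonical `ℤ`-linear map
`ζ : ℚ ⊗_ℤ (∏_{n ≥ 2} ℤ/nℤ) → ∏_{n ≥ 2} (ℚ ⊗_ℤ ℤ/nℤ)`, `x ⊗ (a_n)_n ↦ (x ⊗ a_n)_n`. -/
noncomputable def zeta :
    (ℚ ⊗[ℤ] ((n : {m : ℕ // 2 ≤ m}) → ZMod n.1)) →ₗ[ℤ]
      ((n : {m : ℕ // 2 ≤ m}) → ℚ ⊗[ℤ] ZMod n.1) :=
  LinearMap.pi fun n => LinearMap.lTensor ℚ (LinearMap.proj n)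

theorem subsingleton_rat_tensor_zmod {n : ℕ} (hn : n ≠ 0) :
    Subsingleton (ℚ ⊗[ℤ] ZMod n) := by
  refine subsingleton_of_forall_eq 0 fun z => ?_
  induction z using TensorProduct.induction_on with
  | zero => rfl
  | tmul q a =>
    have hq : q = (n : ℤ) • (q / n) := by
      have : (n : ℚ) ≠ 0 := Nat.cast_ne_zero.mpr hn
      rw [zsmul_eq_mul]
      push_cast
      field_simp
    have ha : (n : ℤ) • a = 0 := by simp
    rw [hq, TensorProduct.smul_tmul, ha, TensorProduct.tmul_zero]
  | add x y hx hy => rw [hx, hy, add_zero]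

theorem one_tmul_one_ne_zero :
    (1 : ℚ) ⊗ₜ[ℤ] (1 : (n : {m : ℕ // 2 ≤ m}) → ZMod n.1) ≠ 0 := by
  intro h
  obtain ⟨s, hs⟩ := (IsLocalizedModule.eq_zero_iff (nonZeroDivisors ℤ)
    (TensorProduct.mk ℤ ℚ ((n : {m : ℕ // 2 ≤ m}) → ZMod n.1) 1)).mp h
  have hs0 : (s : ℤ) ≠ 0 := nonZeroDivisors.ne_zero s.2
  have hcast : ((s : ℤ) : ZMod ((s : ℤ).natAbs + 1)) = 0 := by
    simpa [Submonoid.smul_def] using congrFun hs ⟨(s : ℤ).natAbs + 1, by omega⟩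
  rw [ZMod.intCast_zmod_eq_zero_iff_dvd] at hcast
  have := Nat.le_of_dvd (Int.natAbs_pos.mpr hs0) (Int.natCast_dvd.mp hcast)
  omega

/-- For `n ≥ 2` the module `ℚ ⊗_ℤ ℤ/nℤ` vanishes, so the target of `ζ` is the zero
module; nevertheless the source `ℚ ⊗_ℤ ∏_{n ≥ 2} ℤ/nℤ` is nonzero; in particular `ζ`
is not injective. -/
theorem zeta_not_injective :
    (∀ n : ℕ, 2 ≤ n → Subsingleton (ℚ ⊗[ℤ] ZMod n)) ∧
    Subsingleton ((n : {m : ℕ // 2 ≤ m}) → ℚ ⊗[ℤ] ZMod n.1) ∧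
    Nontrivial (ℚ ⊗[ℤ] ((n : {m : ℕ // 2 ≤ m}) → ZMod n.1)) ∧
    ¬ Function.Injective zeta := by
  have hz : ∀ n : ℕ, 2 ≤ n → Subsingleton (ℚ ⊗[ℤ] ZMod n) := fun n hn =>
    subsingleton_rat_tensor_zmod (by omega)
  have : ∀ n : {m : ℕ // 2 ≤ m}, Subsingleton (ℚ ⊗[ℤ] ZMod n.1) := fun n => hz n.1 n.2
  exact ⟨hz, inferInstance, nontrivial_of_ne _ _ one_tmul_one_ne_zero,
    fun hinj => one_tmul_one_ne_zero (hinj (Subsingleton.elim _ _))⟩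

end Stmt4
end

section
/- Let R be a commutative ring, M a free R-module, ι an index set, and (X_i)_{i ∈ ι} a family of R-modules. Then the canonical R-linear map ζ : M ⊗_R (∏_{i ∈ ι} X_i) → ∏_{i ∈ ι} (M ⊗_R X_i), determined by m ⊗ (x_i)_i ↦ (m ⊗ x_i)_i, is injective. -/
open scoped TensorProduct

namespace Stmt5

/-- The canonical `R`-linear map `ζ : M ⊗_R (∏ᵢ Xᵢ) → ∏ᵢ (M ⊗_R Xᵢ)`,
`m ⊗ (xᵢ)ᵢ ↦ (m ⊗ xᵢ)ᵢ`. -/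
noncomputable def zeta (R : Type*) [CommRing R] (M : Type*) [AddCommGroup M] [Module R M]
    {ι : Type*} (X : ι → Type*) [∀ i, AddCommGroup (X i)] [∀ i, Module R (X i)] :
    (M ⊗[R] ((i : ι) → X i)) →ₗ[R] ((i : ι) → M ⊗[R] X i) :=
  LinearMap.pi fun i => LinearMap.lTensor M (LinearMap.proj i)

/-- The coordinates of a tensor with respect to a basis of the left factor are natural in the
right factor. -/
theorem equivFinsuppOfBasisLeft_lTensor {R M N P κ : Type*} [CommRing R] [AddCommGroup M]
    [Module R M] [AddCommGroup N] [Module R N] [AddCommGroup P] [Module R P] [DecidableEq κ]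
    (b : Module.Basis κ R M) (f : N →ₗ[R] P) (t : M ⊗[R] N) (k : κ) :
    TensorProduct.equivFinsuppOfBasisLeft b (f.lTensor M t) k =
      f (TensorProduct.equivFinsuppOfBasisLeft b t k) := by
  induction t with
  | zero => simp
  | tmul m n => simp
  | add x y hx hy => simp [hx, hy]

/-- If `M` is a free `R`-module then the canonical map
`ζ : M ⊗_R (∏ᵢ Xᵢ) → ∏ᵢ (M ⊗_R Xᵢ)` is injective. -/
theorem zeta_injective (R : Type*) [CommRing R] (M : Type*) [AddCommGroup M] [Module R M]
    [Module.Free R M] (ι : Type*) (X : ι → Type*)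
    [∀ i, AddCommGroup (X i)] [∀ i, Module R (X i)] :
    Function.Injective (zeta R M X) := by
  classical
  let b := Module.Free.chooseBasis R M
  intro s t h
  apply (TensorProduct.equivFinsuppOfBasisLeft b).injective
  ext k i
  have hi : (LinearMap.proj i).lTensor M s = (LinearMap.proj i).lTensor M t := congrFun h i
  simpa only [equivFinsuppOfBasisLeft_lTensor, LinearMap.proj_apply] using
    congrArg (fun u => TensorProduct.equivFinsuppOfBasisLeft b u k) hi

end Stmt5
end

section
/- Let R be a commutative ring and let M, N, P : ℕ → Mod_R be families of R-modules (collections). Define the composition product (M ⊙ P)(n) = ⨁_{k ∈ ℕ} ⨁_{(n₁,…,n_k) ∈ ℕ^k, n₁+⋯+n_k = n} M(n₁) ⊗_R ⋯ ⊗_R M(n_k) ⊗_R P(k), and define the collection H(M,N)(k) = ∏_{(n₁,…,n_k) ∈ ℕ^k} Hom_R(M(n₁) ⊗_R ⋯ ⊗_R M(n_k), N(n₁+⋯+n_k)). Then there is an R-linear isomorphism ∏_{n ∈ ℕ} Hom_R((M ⊙ P)(n), N(n)) ≅ ∏_{k ∈ ℕ} Hom_R(P(k), H(M,N)(k)), natural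 in P and in N. (That is, the monoidal category of collections with the composition product ⊙ is closed, with inner hom H(M,N).) -/
open scoped TensorProduct DirectSum

namespace Stmt6

variable (R : Type) [CommRing R]

/-- The indexing set of the summands of `(M ⊙ P)(n)`: a length `k` together with a
tuple `(n₁, …, n_k)` of natural numbers summing to `n`. -/
abbrev CIdx (n : ℕ) : Type := Σ k : ℕ, {c : Fin k → ℕ // ∑ i, c i = n}

variable (M : ℕ → ModuleCat.{0} R)

/-- The iterated tensor product `M(n₁) ⊗ ⋯ ⊗ M(n_k)` for a tuple `c = (n₁, …, n_k)`. -/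
abbrev TupleTensor {k : ℕ} (c : Fin k → ℕ) : Type := ⨂[R] i : Fin k, ↑(M (c i))

/-- The composition product
`(M ⊙ P)(n) = ⨁ₖ ⨁_{n₁+⋯+n_k = n} M(n₁) ⊗ ⋯ ⊗ M(n_k) ⊗ P(k)`. -/
abbrev Comp (P : ℕ → ModuleCat.{0} R) (n : ℕ) : Type :=
  ⨁ p : CIdx n, (TupleTensor R M p.2.1 ⊗[R] ↑(P p.1))

/-- The inner hom collection
`H(M,N)(k) = ∏_{(n₁,…,n_k)} Hom_R(M(n₁) ⊗ ⋯ ⊗ M(n_k), N(n₁+⋯+n_k))`. -/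
abbrev IHom (N : ℕ → ModuleCat.{0} R) (k : ℕ) : Type :=
  ∀ c : Fin k → ℕ, TupleTensor R M c →ₗ[R] ↑(N (∑ i, c i))

/-- The map `(M ⊙ P)(n) → (M ⊙ P')(n)` induced by a morphism of collections
`g : P → P'`. -/
noncomputable def compMap (P P' : ℕ → ModuleCat.{0} R) (g : ∀ k, ↑(P k) →ₗ[R] ↑(P' k))
    (n : ℕ) : Comp R M P n →ₗ[R] Comp R M P' n :=
  DirectSum.toModule R (CIdx n) (Comp R M P' n) fun p =>
    (DirectSum.lof R (CIdx n) (fun q => TupleTensor R M q.2.1 ⊗[R] ↑(P' q.1)) p).comp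
      (LinearMap.lTensor (TupleTensor R M p.2.1) (g p.1))

/-- Transport along an equality of degrees in a collection. -/
def degreeCast (N : ℕ → ModuleCat.{0} R) {a b : ℕ} (h : a = b) : ↑(N a) →ₗ[R] ↑(N b) :=
  h ▸ LinearMap.id

/-- Currying: a morphism `M ⊙ P → N` gives a morphism `P → H(M,N)`. -/
noncomputable def compCurry (P N : ℕ → ModuleCat.{0} R)
    (f : (n : ℕ) → (Comp R M P n →ₗ[R] ↑(N n))) (k : ℕ) : ↑(P k) →ₗ[R] IHom R M N k :=
  LinearMap.pi fun c => (TensorProduct.curry ((f (∑ i, c i)).comp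
    (DirectSum.lof R (CIdx (∑ i, c i)) (fun q => TupleTensor R M q.2.1 ⊗[R] ↑(P q.1))
      ⟨k, c, rfl⟩))).flip

/-- Uncurrying: a morphism `P → H(M,N)` gives a morphism `M ⊙ P → N`. -/
noncomputable def compUncurry (P N : ℕ → ModuleCat.{0} R)
    (g : (k : ℕ) → (↑(P k) →ₗ[R] IHom R M N k)) (n : ℕ) : Comp R M P n →ₗ[R] ↑(N n) :=
  DirectSum.toModule R (CIdx n) ↑(N n) fun p =>
    (degreeCast R N p.2.2).comp
      (TensorProduct.lift ((LinearMap.proj p.2.1).comp (g p.1)).flip)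

theorem compCurry_apply (P N : ℕ → ModuleCat.{0} R)
    (f : (n : ℕ) → (Comp R M P n →ₗ[R] ↑(N n))) (k : ℕ) (p : ↑(P k)) (c : Fin k → ℕ)
    (t : TupleTensor R M c) :
    compCurry R M P N f k p c t = f (∑ i, c i)
      (DirectSum.lof R (CIdx (∑ i, c i)) (fun q => TupleTensor R M q.2.1 ⊗[R] ↑(P q.1))
        ⟨k, c, rfl⟩ (t ⊗ₜ[R] p)) :=
  rfl

theorem compUncurry_lof_tmul (P N : ℕ → ModuleCat.{0} R)
    (g : (k : ℕ) → (↑(P k) →ₗ[R] IHom R M N k)) (k : ℕ) (c : Fin k → ℕ) (p : ↑(P k))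
    (t : TupleTensor R M c) :
    compUncurry R M P N g (∑ i, c i)
      (DirectSum.lof R (CIdx (∑ i, c i)) (fun q => TupleTensor R M q.2.1 ⊗[R] ↑(P q.1))
        ⟨k, c, rfl⟩ (t ⊗ₜ[R] p)) = g k p c t := by
  rw [compUncurry, DirectSum.toModule_lof]
  rfl

theorem compCurry_compUncurry (P N : ℕ → ModuleCat.{0} R)
    (g : (k : ℕ) → (↑(P k) →ₗ[R] IHom R M N k)) :
    compCurry R M P N (compUncurry R M P N g) = g := by
  funext k
  refine LinearMap.ext fun p => funext fun c => LinearMap.ext fun t => ?_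
  rw [compCurry_apply, compUncurry_lof_tmul]

theorem compUncurry_compCurry (P N : ℕ → ModuleCat.{0} R)
    (f : (n : ℕ) → (Comp R M P n →ₗ[R] ↑(N n))) :
    compUncurry R M P N (compCurry R M P N f) = f := by
  funext n
  refine DirectSum.linearMap_ext R fun q => TensorProduct.ext' fun t p => ?_
  obtain ⟨k, c, rfl⟩ := q
  exact compUncurry_lof_tmul R M P N _ k c p t

/-- The tensor-hom adjunction between `M ⊙ -` and `H(M,-)`. -/
noncomputable def compCurryEquiv (P N : ℕ → ModuleCat.{0} R) :
    ((n : ℕ) → (Comp R M P n →ₗ[R] ↑(N n))) ≃ₗ[R]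
      ((k : ℕ) → (↑(P k) →ₗ[R] IHom R M N k)) where
  toFun := compCurry R M P N
  map_add' f f' := by
    funext k
    refine LinearMap.ext fun p => funext fun c => LinearMap.ext fun t => ?_
    rw [compCurry_apply]
    rfl
  map_smul' r f := by
    funext k
    refine LinearMap.ext fun p => funext fun c => LinearMap.ext fun t => ?_
    rw [compCurry_apply]
    rfl
  invFun := compUncurry R M P N
  left_inv := compUncurry_compCurry R M P N
  right_inv := compCurry_compUncurry R M P N

theorem compCurry_comp (P N N' : ℕ → ModuleCat.{0} R) (h : ∀ n, ↑(N n) →ₗ[R] ↑(N' n))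
    (f : (n : ℕ) → (Comp R M P n →ₗ[R] ↑(N n))) (k : ℕ) (p : ↑(P k)) (c : Fin k → ℕ) :
    compCurry R M P N' (fun n => (h n).comp (f n)) k p c =
      (h (∑ i, c i)).comp (compCurry R M P N f k p c) := by
  refine LinearMap.ext fun t => ?_
  rw [LinearMap.comp_apply, compCurry_apply, compCurry_apply, LinearMap.comp_apply]

theorem compMap_lof_tmul (P P' : ℕ → ModuleCat.{0} R) (g : ∀ k, ↑(P k) →ₗ[R] ↑(P' k))
    (n : ℕ) (q : CIdx n) (t : TupleTensor R M q.2.1) (p : ↑(P q.1)) :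
    compMap R M P P' g n
      (DirectSum.lof R (CIdx n) (fun q => TupleTensor R M q.2.1 ⊗[R] ↑(P q.1)) q (t ⊗ₜ[R] p)) =
      DirectSum.lof R (CIdx n) (fun q => TupleTensor R M q.2.1 ⊗[R] ↑(P' q.1)) q
        (t ⊗ₜ[R] g q.1 p) := by
  rw [compMap, DirectSum.toModule_lof, LinearMap.comp_apply, LinearMap.lTensor_tmul]

theorem compCurry_comp_compMap (P P' N : ℕ → ModuleCat.{0} R)
    (g : ∀ k, ↑(P k) →ₗ[R] ↑(P' k)) (f : (n : ℕ) → (Comp R M P' n →ₗ[R] ↑(N n))) (k : ℕ) :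
    compCurry R M P N (fun n => (f n).comp (compMap R M P P' g n)) k =
      (compCurry R M P' N f k).comp (g k) := by
  refine LinearMap.ext fun p => funext fun c => LinearMap.ext fun t => ?_
  rw [LinearMap.comp_apply, compCurry_apply, compCurry_apply, LinearMap.comp_apply,
    compMap_lof_tmul]

/-- The monoidal category of collections with the composition product `⊙` is closed:
there is an `R`-linear isomorphism
`∏ₙ Hom((M ⊙ P)(n), N(n)) ≅ ∏ₖ Hom(P(k), H(M,N)(k))`, natural in `P` and in `N`. -/
theorem composition_product_closed :
    ∃ e : ∀ (P N : ℕ → ModuleCat.{0} R),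
        ((n : ℕ) → (Comp R M P n →ₗ[R] ↑(N n))) ≃ₗ[R]
          ((k : ℕ) → (↑(P k) →ₗ[R] IHom R M N k)),
      (∀ (P N N' : ℕ → ModuleCat.{0} R) (h : ∀ n, ↑(N n) →ₗ[R] ↑(N' n))
          (f : (n : ℕ) → (Comp R M P n →ₗ[R] ↑(N n))) (k : ℕ) (p : ↑(P k))
          (c : Fin k → ℕ),
          e P N' (fun n => (h n).comp (f n)) k p c =
            (h (∑ i, c i)).comp (e P N f k p c)) ∧
      (∀ (P P' N : ℕ → ModuleCat.{0} R) (g : ∀ k, ↑(P k) →ₗ[R] ↑(P' k))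
          (f : (n : ℕ) → (Comp R M P' n →ₗ[R] ↑(N n))) (k : ℕ),
          e P N (fun n => (f n).comp (compMap R M P P' g n)) k =
            ((e P' N f k).comp (g k))) := by
  exact ⟨compCurryEquiv R M, compCurry_comp R M, compCurry_comp_compMap R M⟩

end Stmt6
end

section
/- For every integer z ≥ 1, the set of all tuples (l, m, l₁,…,l_{m−1}, r₁,…,r_m) where 1 ≤ l ≤ z, 0 ≤ m ≤ z−1, l₀ = l, l_m = 1, each l_j ≥ 1, and each r_j : Fin l_{j−1} → Fin l_j is a monotone surjection, is finite and has cardinality strictly less than 2^{(z−1)² + 2}. -/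
namespace Stmt9

/-- A composable sequence `Fin l = X₀ ↠ X₁ ↠ ⋯ ↠ X_m = Fin 1` of monotone surjections,
where `X_j = Fin l_j`, `l₀ = l`, `l_m = 1` and each `l_j ≥ 1`. -/
def StagedSeq (l m : ℕ) : Type :=
  Σ L : {L : Fin (m + 1) → ℕ // L 0 = l ∧ L (Fin.last m) = 1 ∧ ∀ j, 1 ≤ L j},
    ∀ j : Fin m,
      {r : Fin (L.1 j.castSucc) → Fin (L.1 j.succ) // Monotone r ∧ Function.Surjective r}

section MonotoneSurjection

variable {n k k' : ℕ} {f : Fin (n + 1) → Fin k} {g : Fin (n + 1) → Fin k'}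

theorem val_zero_of_monotone_surjective (hf : Monotone f) (hs : Function.Surjective f) :
    (f 0 : ℕ) = 0 := by
  obtain ⟨i, hi⟩ := hs ⟨0, (f 0).pos⟩
  have h : f 0 ≤ f i := hf (Fin.zero_le i)
  rw [hi, Fin.le_def] at h
  exact Nat.le_zero.mp h

theorem val_succ_le_of_monotone_surjective (hf : Monotone f) (hs : Function.Surjective f)
    (i : Fin n) : (f i.succ : ℕ) ≤ f i.castSucc + 1 := by
  by_contra! h
  obtain ⟨j, hj⟩ := hs ⟨f i.castSucc + 1, h.trans (f i.succ).isLt⟩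
  have hjv : (f j : ℕ) = f i.castSucc + 1 := congrArg Fin.val hj
  rcases le_or_gt j i.castSucc with hji | hji
  · have := Fin.le_def.mp (hf hji)
    omega
  · have := Fin.le_def.mp (hf (Fin.castSucc_lt_iff_succ_le.mp hji))
    omega

/-- A monotone surjection out of `Fin (n + 1)` is determined by the adjacent pairs it collapses. -/
theorem val_eq_of_collapse_iff (hf : Monotone f) (hfs : Function.Surjective f)
    (hg : Monotone g) (hgs : Function.Surjective g)
    (h : ∀ i : Fin n, f i.castSucc = f i.succ ↔ g i.castSucc = g i.succ) (i : Fin (n + 1)) :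
    (f i : ℕ) = g i := by
  induction i using Fin.induction with
  | zero =>
    rw [val_zero_of_monotone_surjective hf hfs, val_zero_of_monotone_surjective hg hgs]
  | succ i ih =>
    have hi := h i
    have hf₁ := val_succ_le_of_monotone_surjective hf hfs i
    have hg₁ := val_succ_le_of_monotone_surjective hg hgs i
    have hf₂ := Fin.le_def.mp (hf i.castSucc_lt_succ.le)
    have hg₂ := Fin.le_def.mp (hg i.castSucc_lt_succ.le)
    rw [Fin.ext_iff, Fin.ext_iff] at hi
    omega

theorem le_of_surjective_of_val_eq (hfs : Function.Surjective f)
    (h : ∀ i, (f i : ℕ) = g i) : k ≤ k' := by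
  by_contra! hk
  obtain ⟨i, hi⟩ := hfs ⟨k', hk⟩
  have := h i
  rw [hi] at this
  exact (g i).isLt.ne' this

end MonotoneSurjection

namespace StagedSeq

variable {l m n : ℕ}

/-- The composite `X₀ → X_j` of the first `j` maps of a staged sequence. -/
def toStage (s : StagedSeq l m) (j : Fin (m + 1)) : Fin l → Fin (s.1.1 j) :=
  Fin.induction (motive := fun j => Fin l → Fin (s.1.1 j)) (Fin.cast s.1.2.1.symm)
    (fun j c => (s.2 j).1 ∘ c) j

theorem toStage_zero (s : StagedSeq l m) : s.toStage 0 = Fin.cast s.1.2.1.symm := rfl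

theorem toStage_succ (s : StagedSeq l m) (j : Fin m) :
    s.toStage j.succ = (s.2 j).1 ∘ s.toStage j.castSucc := by
  simp only [toStage, Fin.induction_succ]

theorem toStage_monotone (s : StagedSeq l m) (j : Fin (m + 1)) : Monotone (s.toStage j) := by
  induction j using Fin.induction with
  | zero => exact fun _ _ h => h
  | succ j ih => rw [toStage_succ]; exact (s.2 j).2.1.comp ih

theorem toStage_surjective (s : StagedSeq l m) (j : Fin (m + 1)) :
    Function.Surjective (s.toStage j) := by
  induction j using Fin.induction with
  | zero => exact (finCongr s.1.2.1.symm).surjective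
  | succ j ih => rw [toStage_succ]; exact (s.2 j).2.2.comp ih

theorem ext_of_toStage {s t : StagedSeq (n + 1) m}
    (h : ∀ j i, (s.toStage j i : ℕ) = t.toStage j i) : s = t := by
  have hL : s.1 = t.1 := Subtype.ext <| funext fun j =>
    (le_of_surjective_of_val_eq (s.toStage_surjective j) (h j)).antisymm
      (le_of_surjective_of_val_eq (t.toStage_surjective j) fun i => (h j i).symm)
  obtain ⟨L, r⟩ := s
  obtain ⟨L', r'⟩ := t
  obtain rfl : L = L' := hL
  have hr : r = r' := by
    funext j
    refine Subtype.ext <| funext fun x => ?_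
    obtain ⟨i, rfl⟩ := toStage_surjective ⟨L, r⟩ j.castSucc x
    have h₁ := congrFun (toStage_succ ⟨L, r⟩ j) i
    have h₂ := congrFun (toStage_succ ⟨L, r'⟩ j) i
    have h₃ : toStage ⟨L, r⟩ j.castSucc i = toStage ⟨L, r'⟩ j.castSucc i :=
      Fin.ext (h j.castSucc i)
    have h₄ : toStage ⟨L, r⟩ j.succ i = toStage ⟨L, r'⟩ j.succ i := Fin.ext (h j.succ i)
    rw [h₁, h₂] at h₄
    simp only [Function.comp_apply] at h₄
    rw [← h₃] at h₄
    exact h₄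
  rw [hr]

/-- Records which adjacent leaves become equal at which stage. -/
def collapse (s : StagedSeq (n + 1) m) (i : Fin n) (j : Fin m) : Bool :=
  decide (s.toStage j.succ i.castSucc = s.toStage j.succ i.succ)

theorem collapse_injective : Function.Injective (collapse (n := n) (m := m)) := by
  intro s t hst
  refine ext_of_toStage fun j => ?_
  induction j using Fin.cases with
  | zero => exact fun _ => rfl
  | succ j =>
    refine val_eq_of_collapse_iff (s.toStage_monotone _) (s.toStage_surjective _)
      (t.toStage_monotone _) (t.toStage_surjective _) fun i => ?_
    exact decide_eq_decide.mp (congrFun (congrFun hst i) j)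

theorem exists_injective (hl : 1 ≤ l) :
    ∃ f : StagedSeq l m → Fin (l - 1) → Fin m → Bool, Function.Injective f := by
  obtain ⟨n, rfl⟩ := Nat.exists_eq_add_of_le' hl
  exact ⟨collapse, collapse_injective⟩

end StagedSeq

theorem sum_two_pow_mul_lt (a n : ℕ) (ha : 1 ≤ a) :
    ∑ m ∈ Finset.range (n + 1), 2 ^ (a * m) < 2 ^ (a * n + 1) := by
  induction n with
  | zero => simp
  | succ n ih =>
    rw [Finset.sum_range_succ]
    have h : 2 ^ (a * n + 1) ≤ 2 ^ (a * (n + 1)) :=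
      Nat.pow_le_pow_right two_pos (by rw [Nat.mul_succ]; omega)
    rw [pow_succ 2 (a * (n + 1))]
    omega

theorem sum_sum_two_pow_mul_lt (n : ℕ) :
    ∑ a ∈ Finset.range (n + 1), ∑ m ∈ Finset.range (n + 1), 2 ^ (a * m) < 2 ^ (n ^ 2 + 2) := by
  rcases Nat.eq_zero_or_pos n with rfl | hn
  · simp
  have hsum : ∑ a ∈ Finset.range n, (∑ m ∈ Finset.range (n + 1), 2 ^ ((a + 1) * m) + 1) ≤
      ∑ a ∈ Finset.range n, 2 * 2 ^ (n * (a + 1)) := by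
    refine Finset.sum_le_sum fun a _ => ?_
    have := sum_two_pow_mul_lt (a + 1) n (Nat.le_add_left 1 a)
    rwa [pow_succ, mul_comm _ 2, mul_comm (a + 1) n] at this
  have hgeom := sum_two_pow_mul_lt n n hn
  rw [Finset.sum_range_succ', mul_zero, pow_zero] at hgeom
  rw [Finset.sum_add_distrib, ← Finset.mul_sum] at hsum
  rw [Finset.sum_range_succ']
  simp only [zero_mul, pow_zero, Finset.sum_const, Finset.card_range, smul_eq_mul,
    mul_one] at hsum ⊢
  rw [pow_succ, ← pow_two] at hgeom
  rw [pow_add]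
  omega

/-- For `z ≥ 1`, the set of all staged sequences of monotone surjections with
`1 ≤ l ≤ z` leaves and height `0 ≤ m ≤ z - 1` is finite, of cardinality strictly
less than `2^((z-1)² + 2)`. -/
theorem card_all_stagedSeq_lt (z : ℕ) (hz : 1 ≤ z) :
    Finite (Σ l : {l : ℕ // 1 ≤ l ∧ l ≤ z}, Σ m : {m : ℕ // m ≤ z - 1},
        StagedSeq l.1 m.1) ∧
    Nat.card (Σ l : {l : ℕ // 1 ≤ l ∧ l ≤ z}, Σ m : {m : ℕ // m ≤ z - 1},
        StagedSeq l.1 m.1) < 2 ^ ((z - 1) ^ 2 + 2) := by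
  obtain ⟨n, rfl⟩ := Nat.exists_eq_add_of_le' hz
  rw [Nat.add_sub_cancel]
  choose code hcode using fun (l : {l : ℕ // 1 ≤ l ∧ l ≤ n + 1}) (m : {m : ℕ // m ≤ n}) =>
    StagedSeq.exists_injective (m := m.1) l.2.1
  let leaves (l : {l : ℕ // 1 ≤ l ∧ l ≤ n + 1}) : Fin (n + 1) := ⟨l.1 - 1, by omega⟩
  let height (m : {m : ℕ // m ≤ n}) : Fin (n + 1) := ⟨m.1, by omega⟩
  have hleaves : Function.Injective leaves := fun l l' h => by
    have := Fin.ext_iff.mp h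
    simp only [leaves] at this
    exact Subtype.ext (by omega)
  have hheight : Function.Injective height := fun m m' h => Subtype.ext (Fin.ext_iff.mp h)
  let F : (Σ l : {l : ℕ // 1 ≤ l ∧ l ≤ n + 1}, Σ m : {m : ℕ // m ≤ n}, StagedSeq l.1 m.1) →
      Σ a : Fin (n + 1), Σ m : Fin (n + 1), (Fin a → Fin m → Bool) :=
    Sigma.map leaves fun l => Sigma.map height fun m => code l m
  have hF : Function.Injective F :=
    hleaves.sigma_map fun l => hheight.sigma_map fun m => hcode l m
  refine ⟨Finite.of_injective F hF, (Nat.card_le_card_of_injective F hF).trans_lt ?_⟩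
  have hcard : Nat.card (Σ a : Fin (n + 1), Σ m : Fin (n + 1), (Fin a → Fin m → Bool)) =
      ∑ a ∈ Finset.range (n + 1), ∑ m ∈ Finset.range (n + 1), 2 ^ (a * m) := by
    simp [Finset.sum_range, ← pow_mul, mul_comm]
  exact hcard ▸ sum_sum_two_pow_mul_lt n

end Stmt9
end

section
/- Let V be a symmetric monoidal preadditive category (for instance the category of modules over a commutative ring with the tensor product). Let C(n), n ∈ ℕ, be a family of objects of V equipped with morphisms Δ_{x,y,z} : C(x+y+z) → C(y) ⊗ C(x+1+z) for all x, y, z ∈ ℕ satisfying the two coassociativity laws of a pseudo-cooperad: (I) for all v,w,x,y,z: Δ_{v,w,x+y+z} ≫ (id_{C(w)} ⊗ Δ_{v+1+x,y,z}) ≫ (swap of the first two tensor factors) = Δ_{v+w+x,y,z} ≫ (id_{C(y)} ⊗ Δ_{v,w,x+1+z}), as morphisms C(v+w+x+y+z) → C(y) ⊗ C(w) ⊗ C(v+1+x+1+z); (II) for all v,w,x,y,z: Δ_{v+w,x,y+z} ≫ (id_{C(x)} ⊗ Δ_{v,w+1+y,z}) = Δ_{v,w+x+y,z} ≫ (Δ_{w,x,y}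 ⊗ id_{C(v+1+z)}), as morphisms C(v+w+x+y+z) → C(x) ⊗ C(w+1+y) ⊗ C(v+1+z). Then for any morphism ψ : C(1) → 𝟙, the family ξ_n := Δ_{0,n,0} ≫ (id ⊗ ψ) ≫ (right unitor) − Σ_{e+1+f=n} Δ_{e,1,f} ≫ (ψ ⊗ id) ≫ (left unitor) : C(n) → C(n) is a coderivation: for all a, b, c ∈ ℕ, ξ_{a+b+c} ≫ Δ_{a,b,c} = Δ_{a,b,c} ≫ (ξ_b ⊗ id_{C(a+1+c)} + id_{C(b)} ⊗ ξ_{a+1+c}). -/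
open CategoryTheory CategoryTheory.MonoidalCategory

namespace Stmt10

variable {V : Type*} [Category V] [Preadditive V] [MonoidalCategory V]
  [MonoidalPreadditive V] [SymmetricCategory V]

/-- Reindexing morphism `C a ⟶ C b` along an equality `a = b` of natural numbers. -/
def e (C : ℕ → V) {a b : ℕ} (h : a = b) : C a ⟶ C b := eqToHom (congrArg C h)

/-- The inner coderivation
`ξ_n = Δ_{0,n,0} ≫ (id ⊗ ψ) ≫ (unitor) − Σ_{e+1+f=n} Δ_{e,1,f} ≫ (ψ ⊗ id) ≫ (unitor)`
determined by a functional `ψ : C(1) ⟶ 𝟙`. -/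
noncomputable def xi (C : ℕ → V) (Δ : ∀ x y z : ℕ, C (x + y + z) ⟶ C y ⊗ C (x + 1 + z))
    (ψ : C 1 ⟶ 𝟙_ V) (n : ℕ) : C n ⟶ C n :=
  (e C (show n = 0 + n + 0 by omega) ≫ Δ 0 n 0 ≫
      (C n ◁ (e C (show 0 + 1 + 0 = 1 by omega) ≫ ψ)) ≫ (ρ_ (C n)).hom) -
    ∑ a ∈ (Finset.range n).attach,
      e C (show n = a.1 + 1 + (n - 1 - a.1) by
            have := Finset.mem_range.mp a.2; omega) ≫
        Δ a.1 1 (n - 1 - a.1) ≫ (ψ ▷ C (a.1 + 1 + (n - 1 - a.1))) ≫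
        (λ_ (C (a.1 + 1 + (n - 1 - a.1)))).hom ≫
        e C (show a.1 + 1 + (n - 1 - a.1) = n by
            have := Finset.mem_range.mp a.2; omega)

/-- The comultiplication `Δ x y z` with source and second target reindexed. -/
def reindexedComul (C : ℕ → V) (Δ : ∀ x y z : ℕ, C (x + y + z) ⟶ C y ⊗ C (x + 1 + z))
    (x y z n m : ℕ) (hn : n = x + y + z) (hm : x + 1 + z = m) : C n ⟶ C y ⊗ C m :=
  e C hn ≫ Δ x y z ≫ C y ◁ e C hm

/-- Apply `ψ` to the second tensor factor of `Δ 0 n 0`. -/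
def rootContraction (C : ℕ → V) (Δ : ∀ x y z : ℕ, C (x + y + z) ⟶ C y ⊗ C (x + 1 + z))
    (ψ : C 1 ⟶ 𝟙_ V) (n : ℕ) : C n ⟶ C n :=
  reindexedComul C Δ 0 n 0 n 1 (by omega) rfl ≫ C n ◁ ψ ≫ (ρ_ (C n)).hom

/-- Apply `ψ` to the first tensor factor of `Δ x 1 (n - 1 - x)`; zero unless `x < n`. -/
noncomputable def leafContraction (C : ℕ → V)
    (Δ : ∀ x y z : ℕ, C (x + y + z) ⟶ C y ⊗ C (x + 1 + z))
    (ψ : C 1 ⟶ 𝟙_ V) (n x : ℕ) : C n ⟶ C n :=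
  if h : x < n then
    reindexedComul C Δ x 1 (n - 1 - x) n n (by omega) (by omega) ≫ ψ ▷ C n ≫ (λ_ (C n)).hom
  else 0

section

set_option linter.unusedSectionVars false

variable {C : ℕ → V} {Δ : ∀ x y z : ℕ, C (x + y + z) ⟶ C y ⊗ C (x + 1 + z)}

theorem leafContraction_eq (ψ : C 1 ⟶ 𝟙_ V) {n x z : ℕ} (h : n = x + 1 + z) :
    leafContraction C Δ ψ n x =
      reindexedComul C Δ x 1 z n n h h.symm ≫ ψ ▷ C n ≫ (λ_ (C n)).hom := by
  obtain rfl : z = n - 1 - x := by omega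
  rw [leafContraction, dif_pos (by omega)]

theorem reindexedComul_self (x y z : ℕ) :
    reindexedComul C Δ x y z _ _ rfl rfl = Δ x y z := by
  simp [reindexedComul, e]

theorem xi_eq (ψ : C 1 ⟶ 𝟙_ V) (n : ℕ) :
    xi C Δ ψ n =
      rootContraction C Δ ψ n - ∑ x ∈ Finset.range n, leafContraction C Δ ψ n x := by
  rw [← Finset.sum_attach, xi]
  congr 1
  · simp [rootContraction, reindexedComul]
  · refine Finset.sum_congr rfl fun x _ => ?_
    have hx := Finset.mem_range.mp x.2
    rw [leafContraction, dif_pos hx, reindexedComul]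
    simp only [Category.assoc, ← leftUnitor_naturality, whisker_exchange_assoc]

/-- Coassociativity for two inputs attached in parallel. -/
def ParallelCoassoc (C : ℕ → V)
    (Δ : ∀ x y z : ℕ, C (x + y + z) ⟶ C y ⊗ C (x + 1 + z)) : Prop :=
  ∀ v w x y z n p q r c d a : ℕ, ∀ (_ : c = x + y + z) (_ : a = v + 1 + x)
    (_ : d = x + 1 + z) (hb : n = v + w + c) (hp : v + 1 + c = p) (hp' : p = a + y + z)
    (hr : a + 1 + z = r) (hn : n = v + w + x + y + z) (hq : v + w + x + 1 + z = q)
    (hq' : q = v + w + d) (hr' : v + 1 + d = r),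
    reindexedComul C Δ v w c n p hb hp ≫ C w ◁ reindexedComul C Δ a y z p r hp' hr ≫
        (α_ (C w) (C y) (C r)).inv ≫ (β_ (C w) (C y)).hom ▷ C r ≫ (α_ (C y) (C w) (C r)).hom =
      reindexedComul C Δ (v + w + x) y z n q hn hq ≫
        C y ◁ reindexedComul C Δ v w d q r hq' hr'

/-- Coassociativity for two nested inputs. -/
def NestedCoassoc (C : ℕ → V)
    (Δ : ∀ x y z : ℕ, C (x + y + z) ⟶ C y ⊗ C (x + 1 + z)) : Prop :=
  ∀ v w x y z n p q r s a c : ℕ, ∀ (_ : a = v + w) (_ : c = y + z) (hn : n = a + x + c)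
    (hs : a + 1 + c = s) (hs' : s = v + q + z) (hr : v + 1 + z = r) (hn' : n = v + p + z)
    (hp : p = w + x + y) (hq : w + 1 + y = q),
    reindexedComul C Δ a x c n s hn hs ≫ C x ◁ reindexedComul C Δ v q z s r hs' hr =
      reindexedComul C Δ v p z n r hn' hr ≫ reindexedComul C Δ w x y p q hp hq ▷ C r ≫
        (α_ (C x) (C q) (C r)).hom

theorem rootContraction_comp_comul (hC : NestedCoassoc C Δ) (ψ : C 1 ⟶ 𝟙_ V) (a b c : ℕ) :
    rootContraction C Δ ψ (a + b + c) ≫ Δ a b c =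
      Δ a b c ≫ C b ◁ rootContraction C Δ ψ (a + 1 + c) := by
  have h := hC 0 a b c 0 (a + b + c) (a + b + c) (a + 1 + c) 1 (a + 1 + c) a c
    (by omega) (by omega) rfl rfl (by omega) rfl (by omega) rfl rfl
  rw [reindexedComul_self] at h
  simp only [rootContraction, MonoidalCategory.whiskerLeft_comp, reassoc_of% h, Category.assoc,
    ← rightUnitor_naturality, whisker_exchange_assoc]
  simp

theorem comul_comp_rootContraction (hC : NestedCoassoc C Δ) (ψ : C 1 ⟶ 𝟙_ V) (a b c : ℕ) :
    Δ a b c ≫ rootContraction C Δ ψ b ▷ C (a + 1 + c) =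
      Δ a b c ≫ C b ◁ leafContraction C Δ ψ (a + 1 + c) a := by
  have h := hC a 0 b 0 c (a + b + c) b 1 (a + 1 + c) (a + 1 + c) a c
    (by omega) (by omega) rfl rfl rfl rfl rfl (by omega) rfl
  rw [reindexedComul_self] at h
  simp only [leafContraction_eq ψ (show a + 1 + c = a + 1 + c from rfl), rootContraction,
    MonoidalCategory.whiskerLeft_comp, reassoc_of% h]
  simp

theorem leafContraction_comp_comul (ψ : C 1 ⟶ 𝟙_ V) {a b c x z : ℕ}
    (h : a + b + c = x + 1 + z) :
    leafContraction C Δ ψ (a + b + c) x ≫ Δ a b c =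
      reindexedComul C Δ x 1 z _ _ h h.symm ≫ C 1 ◁ Δ a b c ≫
        ψ ▷ (C b ⊗ C (a + 1 + c)) ≫ (λ_ (C b ⊗ C (a + 1 + c))).hom := by
  rw [leafContraction_eq ψ h]
  simp only [Category.assoc, ← leftUnitor_naturality, whisker_exchange_assoc]

theorem leafContraction_comp_comul_middle (hC : NestedCoassoc C Δ) (ψ : C 1 ⟶ 𝟙_ V)
    (a b c : ℕ) {x : ℕ} (hx : x < b) :
    leafContraction C Δ ψ (a + b + c) (a + x) ≫ Δ a b c =
      Δ a b c ≫ leafContraction C Δ ψ b x ▷ C (a + 1 + c) := by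
  obtain ⟨y, rfl⟩ := Nat.exists_eq_add_of_lt hx
  have h := hC a x 1 y c (a + (x + y + 1) + c) (x + y + 1) (x + y + 1) (a + 1 + c)
    (a + (x + y + 1) + c) (a + x) (y + c)
    rfl rfl (by omega) (by omega) rfl rfl rfl (by omega) (by omega)
  rw [reindexedComul_self] at h
  rw [leafContraction_comp_comul ψ (z := y + c) (by omega),
    leafContraction_eq ψ (show x + y + 1 = x + 1 + y by omega), reassoc_of% h]
  simp

theorem whiskerLeft_leafContraction (ψ : C 1 ⟶ 𝟙_ V) (b : ℕ) {n x z : ℕ} (h : n = x + 1 + z) :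
    C b ◁ leafContraction C Δ ψ n x =
      C b ◁ reindexedComul C Δ x 1 z n n h h.symm ≫ (α_ (C b) (C 1) (C n)).inv ≫
        (β_ (C b) (C 1)).hom ▷ C n ≫ (α_ (C 1) (C b) (C n)).hom ≫
        ψ ▷ (C b ⊗ C n) ≫ (λ_ (C b ⊗ C n)).hom := by
  have hb : (β_ (C b) (C 1)).hom ≫ ψ ▷ C b ≫ (λ_ (C b)).hom = C b ◁ ψ ≫ (ρ_ (C b)).hom := by
    rw [← BraidedCategory.braiding_naturality_right_assoc, braiding_leftUnitor]
  have hb' := congrArg (· ▷ C n) hb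
  simp only [comp_whiskerRight] at hb'
  rw [leafContraction_eq ψ h]
  simp only [MonoidalCategory.whiskerLeft_comp, leftUnitor_tensor_hom, whiskerRight_tensor,
    Category.assoc, Iso.hom_inv_id_assoc, hb']
  simp

theorem leafContraction_comp_comul_left (hC : ParallelCoassoc C Δ) (ψ : C 1 ⟶ 𝟙_ V)
    (a b c : ℕ) {x : ℕ} (hx : x < a) :
    leafContraction C Δ ψ (a + b + c) x ≫ Δ a b c =
      Δ a b c ≫ C b ◁ leafContraction C Δ ψ (a + 1 + c) x := by
  obtain ⟨y, hy⟩ := Nat.exists_eq_add_of_lt hx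
  obtain rfl : a = x + 1 + y := by omega
  have h := hC x 1 y b c _ _ _ (x + 1 + y + 1 + c) (y + b + c) (y + 1 + c) (x + 1 + y)
    rfl rfl rfl (by omega) (show _ = x + 1 + y + b + c by omega) rfl rfl rfl rfl (by omega)
    (by omega)
  simp only [reindexedComul_self] at h
  rw [leafContraction_comp_comul ψ (z := y + b + c) (by omega),
    whiskerLeft_leafContraction ψ b (z := y + 1 + c) (by omega), ← reassoc_of% h]
  simp only [Iso.hom_inv_id_assoc, Iso.inv_hom_id_assoc,
    ← comp_whiskerRight_assoc, SymmetricCategory.symmetry, id_whiskerRight, Category.id_comp]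

theorem leafContraction_comp_comul_right (hC : ParallelCoassoc C Δ) (ψ : C 1 ⟶ 𝟙_ V)
    (a b c : ℕ) {x : ℕ} (hx : x < c) :
    leafContraction C Δ ψ (a + b + c) (a + b + x) ≫ Δ a b c =
      Δ a b c ≫ C b ◁ leafContraction C Δ ψ (a + 1 + c) (a + 1 + x) := by
  obtain ⟨y, hy⟩ := Nat.exists_eq_add_of_lt hx
  obtain rfl : c = x + 1 + y := by omega
  have h := hC a b x 1 y (a + b + (x + 1 + y)) (a + 1 + (x + 1 + y)) (a + b + (x + 1 + y))
    (a + 1 + (x + 1 + y)) (x + 1 + y) (x + 1 + y) (a + 1 + x)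
    rfl rfl rfl rfl rfl (by omega) (by omega) (by omega) (by omega) rfl rfl
  simp only [reindexedComul_self] at h
  rw [leafContraction_comp_comul ψ (z := y) (by omega),
    whiskerLeft_leafContraction ψ b (z := y) (by omega), ← reassoc_of% h]

end

/-- For a pseudo-cooperad `(C, Δ)` in a symmetric monoidal preadditive category and a
functional `ψ : C(1) ⟶ 𝟙`, the family `ξ` is an `id_C`-coderivation. -/
theorem inner_coderivation (C : ℕ → V)
    (Δ : ∀ x y z : ℕ, C (x + y + z) ⟶ C y ⊗ C (x + 1 + z))
    (lawI : ∀ v w x y z : ℕ,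
      e C (show v + w + x + y + z = v + w + (x + y + z) by omega) ≫ Δ v w (x + y + z) ≫
          (C w ◁ (e C (show v + 1 + (x + y + z) = v + 1 + x + y + z by omega) ≫
            Δ (v + 1 + x) y z)) ≫
          (α_ (C w) (C y) (C (v + 1 + x + 1 + z))).inv ≫
          ((β_ (C w) (C y)).hom ▷ C (v + 1 + x + 1 + z)) ≫
          (α_ (C y) (C w) (C (v + 1 + x + 1 + z))).hom =
        Δ (v + w + x) y z ≫
          (C y ◁ (e C (show v + w + x + 1 + z = v + w + (x + 1 + z) by omega) ≫
            Δ v w (x + 1 + z) ≫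
            (C w ◁ e C (show v + 1 + (x + 1 + z) = v + 1 + x + 1 + z by omega)))))
    (lawII : ∀ v w x y z : ℕ,
      e C (show v + w + x + y + z = v + w + x + (y + z) by omega) ≫
          Δ (v + w) x (y + z) ≫
          (C x ◁ (e C (show v + w + 1 + (y + z) = v + (w + 1 + y) + z by omega) ≫
            Δ v (w + 1 + y) z)) =
        e C (show v + w + x + y + z = v + (w + x + y) + z by omega) ≫
          Δ v (w + x + y) z ≫ (Δ w x y ▷ C (v + 1 + z)) ≫
          (α_ (C x) (C (w + 1 + y)) (C (v + 1 + z))).hom)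
    (ψ : C 1 ⟶ 𝟙_ V) (a b c : ℕ) :
    xi C Δ ψ (a + b + c) ≫ Δ a b c =
      Δ a b c ≫ (xi C Δ ψ b ▷ C (a + 1 + c) + C b ◁ xi C Δ ψ (a + 1 + c)) := by
  have hI : ParallelCoassoc C Δ := by
    intro v w x y z n p q r c d a hc ha hd hb hp hp' hr hn hq hq' hr'
    subst hc ha hd hn hp hq hr
    simpa [reindexedComul, e] using lawI v w x y z
  have hII : NestedCoassoc C Δ := by
    intro v w x y z n p q r s a c ha hc hn hs hs' hr hn' hp hq
    subst ha hc hp hq hr hs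
    obtain rfl : n = v + w + x + y + z := by omega
    simpa [reindexedComul, e] using lawII v w x y z
  have hsubl (P : V) {Q R : V} (f g : Q ⟶ R) : P ◁ (f - g) = P ◁ f - P ◁ g :=
    (tensorLeft P).map_sub
  have hsubr (P : V) {Q R : V} (f g : Q ⟶ R) : (f - g) ▷ P = f ▷ P - g ▷ P :=
    (tensorRight P).map_sub
  simp only [xi_eq, Finset.sum_range_add, Finset.sum_range_one, Preadditive.sub_comp,
    Preadditive.add_comp, Preadditive.sum_comp, hsubr, hsubl, MonoidalPreadditive.whiskerLeft_add,
    sum_whiskerRight, whiskerLeft_sum, Preadditive.comp_add,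
    Preadditive.comp_sub, Preadditive.comp_sum, rootContraction_comp_comul hII,
    comul_comp_rootContraction hII, add_zero]
  rw [Finset.sum_congr rfl fun x hx =>
      leafContraction_comp_comul_left hI ψ a b c (Finset.mem_range.mp hx),
    Finset.sum_congr rfl fun x hx =>
      leafContraction_comp_comul_middle hII ψ a b c (Finset.mem_range.mp hx),
    Finset.sum_congr rfl fun x hx =>
      leafContraction_comp_comul_right hI ψ a b c (Finset.mem_range.mp hx)]
  abel

end Stmt10
end

section
/- Let t ≥ 1 be an integer and n₀, n₁, …, n_t ∈ ℕ. In the free abelian group on the set of finite lists of natural numbers, the following identity holds: Σ_{i=1}^{t} (χ(n_i > 0) − χ(n_{i−1} > 0)) · [n₀, …, n_{i−2}, n_{i−1}+n_i, n_{i+1}, …, n_t] = χ(n₀ = 0) · [n₁, …, n_t] − χ(n_t = 0) · [n₀, …, n_{t−1}], where [·] denotes the basis element indexed by the displayed list (of length t on the left-hand side) and χ(P) ∈ {0,1} is 1 exactly when the condition P holds. -/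
namespace Stmt12

/-- The list `(n₀, …, n_{i-1} + n_i, …, n_t)` of length `t` obtained from
`(n₀, …, n_t)` by merging the consecutive pair at positions `i`, `i+1` (here
`i : Fin t` encodes the pair `(n_i, n_{i+1})` in 0-based indexing). -/
def mergeList {t : ℕ} (n : Fin (t + 1) → ℕ) (i : Fin t) : List ℕ :=
  List.ofFn fun j : Fin t =>
    if j < i then n j.castSucc else if j = i then n i.castSucc + n i.succ else n j.succ

/-- If `n_i = 0`, merging the pair `(n_i, n_{i+1})` amounts to deleting `n_i`. -/
theorem mergeList_of_castSucc_eq_zero {t : ℕ} {n : Fin (t + 1) → ℕ} {i : Fin t}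
    (h : n i.castSucc = 0) : mergeList n i = List.ofFn (i.castSucc.removeNth n) := by
  refine congrArg List.ofFn (funext fun j => ?_)
  rcases lt_trichotomy j i with hj | rfl | hj
  · simp [Fin.removeNth_apply, hj, Fin.succAbove_castSucc_of_lt]
  · simp [Fin.removeNth_apply, h]
  · simp [Fin.removeNth_apply, hj.not_gt, hj.ne', Fin.succAbove_castSucc_of_le _ _ hj.le]

/-- If `n_{i+1} = 0`, merging the pair `(n_i, n_{i+1})` amounts to deleting `n_{i+1}`. -/
theorem mergeList_of_succ_eq_zero {t : ℕ} {n : Fin (t + 1) → ℕ} {i : Fin t}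
    (h : n i.succ = 0) : mergeList n i = List.ofFn (i.succ.removeNth n) := by
  refine congrArg List.ofFn (funext fun j => ?_)
  rcases lt_trichotomy j i with hj | rfl | hj
  · simp [Fin.removeNth_apply, hj, Fin.succAbove_succ_of_le _ _ hj.le]
  · simp [Fin.removeNth_apply, h]
  · simp [Fin.removeNth_apply, hj.not_gt, hj.ne', Fin.succAbove_succ_of_lt _ _ hj]

/-- The basis element of `n` with its `k`-th entry deleted if that entry is zero, and `0`
otherwise. -/
def deleteZero {t : ℕ} (n : Fin (t + 1) → ℕ) (k : Fin (t + 1)) : FreeAbelianGroup (List ℕ) :=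
  (if n k = 0 then 1 else 0 : ℤ) • FreeAbelianGroup.of (List.ofFn (k.removeNth n))

theorem smul_mergeList_eq_deleteZero_sub {t : ℕ} (n : Fin (t + 1) → ℕ) (i : Fin t) :
    (((if 0 < n i.succ then 1 else 0) - (if 0 < n i.castSucc then 1 else 0) : ℤ)) •
        FreeAbelianGroup.of (mergeList n i) =
      deleteZero n i.castSucc - deleteZero n i.succ := by
  by_cases h₀ : n i.castSucc = 0 <;> by_cases h₁ : n i.succ = 0
  · simp [deleteZero, h₀, h₁, ← mergeList_of_castSucc_eq_zero h₀, ← mergeList_of_succ_eq_zero h₁]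
  · simp [deleteZero, h₀, h₁, Nat.pos_of_ne_zero, mergeList_of_castSucc_eq_zero h₀]
  · simp [deleteZero, h₀, h₁, Nat.pos_of_ne_zero, mergeList_of_succ_eq_zero h₁]
  · simp [deleteZero, h₀, h₁, Nat.pos_of_ne_zero]

/-- In the free abelian group on finite lists of natural numbers:
`Σᵢ (χ(nᵢ > 0) − χ(n_{i−1} > 0)) · [merge_i] = χ(n₀ = 0)·[n₁,…,n_t] − χ(n_t = 0)·[n₀,…,n_{t−1}]`. -/
theorem merge_identity (t : ℕ) (ht : 1 ≤ t) (n : Fin (t + 1) → ℕ) :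
    ∑ i : Fin t,
        (((if 0 < n i.succ then 1 else 0) - (if 0 < n i.castSucc then 1 else 0) : ℤ)) •
          FreeAbelianGroup.of (mergeList n i) =
      ((if n 0 = 0 then 1 else 0 : ℤ)) •
          FreeAbelianGroup.of (List.ofFn fun j : Fin t => n j.succ) -
        ((if n (Fin.last t) = 0 then 1 else 0 : ℤ)) •
          FreeAbelianGroup.of (List.ofFn fun j : Fin t => n j.castSucc) := by
  have key := (Fin.sum_univ_succ (deleteZero n)).symm.trans (Fin.sum_univ_castSucc _)
  simp only [smul_mergeList_eq_deleteZero_sub, Finset.sum_sub_distrib]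
  have h₀ : (Fin.removeNth 0 n) = fun j => n j.succ := by
    ext j; simp [Fin.removeNth_apply]
  have h₁ : (Fin.removeNth (Fin.last t) n) = fun j => n j.castSucc := by
    ext j; simp [Fin.removeNth_apply]
  rw [← h₀, ← h₁]
  change _ = deleteZero n 0 - deleteZero n (Fin.last t)
  rw [sub_eq_sub_iff_add_eq_add, key]

end Stmt12
end
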